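/- arXiv:1611.02471 — 4 statements merged into one kernel-verified Lean document; each statement's English description precedes it below -/
import Mathlib

section
/- Let R be a commutative ring, I ⊂ R an ideal, and P, Q finitely generated projective (R/I)-modules. Let α : P → I/I² and β : Q → I/I² be surjective (R/I)-linear maps and ψ : P → Q a homomorphism with β ∘ ψ = α. If P and Q both have constant rank equal to r and I has height r (so that I/I² is generated by r elements locally and P, Q have the same rank), then ψ is an isomorphism. -/
open Order

/-- The height of an ideal: the infimum of the heights of the primes containing it. -/
noncomputable def idealHeight {R : Type*} [CommRing R] (I : Ideal R) : ℕ∞ :=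
  ⨅ (p : PrimeSpectrum R) (_ : I ≤ p.asIdeal), Order.height p

open TensorProduct in
lemma aux_mem {A M : Type*} [CommRing A] [AddCommGroup M] [Module A M] (m : Ideal A) (x : M)
    (h : (1 : A ⧸ m) ⊗ₜ[A] x = 0) : x ∈ m • (⊤ : Submodule A M) := by
  have := congrArg (TensorProduct.quotTensorEquivQuotSMul M m) h
  rw [TensorProduct.quotTensorEquivQuotSMul_mk_one_tmul, map_zero] at this
  exact (Submodule.Quotient.mk_eq_zero _).1 this

open TensorProduct in
lemma aux_surj {A M : Type*} [CommRing A] [AddCommGroup M] [Module A M] (m : Ideal A)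
    (t : (A ⧸ m) ⊗[A] M) : ∃ x : M, (1 : A ⧸ m) ⊗ₜ[A] x = t :=
  TensorProduct.mk_surjective A M (A ⧸ m) Ideal.Quotient.mk_surjective t

open TensorProduct in
lemma aux_finrank {A M : Type*} [CommRing A] [AddCommGroup M] [Module A M]
    [Module.Finite A M] [Module.Projective A M] (m : Ideal A) (hm : m.IsMaximal) (r : ℕ)
    (h : ∀ p : PrimeSpectrum A, Module.rankAtStalk M p = r) :
    Module.finrank (A ⧸ m) ((A ⧸ m) ⊗[A] M) = r := by
  let := Ideal.Quotient.field m
  have h1 := Module.rankAtStalk_baseChange (R := A) (M := M) (S := A ⧸ m) ⊥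
  rw [h, Module.rankAtStalk_eq_finrank_of_free] at h1
  simpa using h1

open TensorProduct in
lemma aux_top_le {A P Q C : Type*} [CommRing A] [AddCommGroup P] [Module A P]
    [AddCommGroup Q] [Module A Q] [AddCommGroup C] [Module A C] [Module.Finite A Q]
    (m : Ideal A) (hm : m.IsMaximal) (r : ℕ)
    (hQ : Module.finrank (A ⧸ m) ((A ⧸ m) ⊗[A] Q) = r)
    (hC : r ≤ Module.finrank (A ⧸ m) ((A ⧸ m) ⊗[A] C))
    (α : P →ₗ[A] C) (hα : Function.Surjective α) (β : Q →ₗ[A] C) (hβ : Function.Surjective β)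
    (ψ : P →ₗ[A] Q) (hψ : β ∘ₗ ψ = α) :
    (⊤ : Submodule A Q) ≤ LinearMap.range ψ ⊔ m • (⊤ : Submodule A Q) := by
  let := Ideal.Quotient.field m
  have : Module.Finite A C := Module.Finite.of_surjective β hβ
  have hbs : Function.Surjective (β.baseChange (A ⧸ m)) := LinearMap.lTensor_surjective _ hβ
  have has : Function.Surjective (α.baseChange (A ⧸ m)) := LinearMap.lTensor_surjective _ hα
  have hle := LinearMap.finrank_le_finrank_of_surjective hbs
  have hbi : Function.Injective (β.baseChange (A ⧸ m)) :=
    (LinearMap.injective_iff_surjective_of_finrank_eq_finrank (by omega)).2 hbs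
  intro q _
  obtain ⟨t, ht⟩ := has (β.baseChange (A ⧸ m) (1 ⊗ₜ q))
  obtain ⟨p, rfl⟩ := aux_surj m t
  have h1 : (1 : A ⧸ m) ⊗ₜ[A] ψ p = 1 ⊗ₜ[A] q := by
    apply hbi
    rw [← ht, ← hψ]
    simp
  have h2 : q - ψ p ∈ m • (⊤ : Submodule A Q) := by
    apply aux_mem
    rw [TensorProduct.tmul_sub, h1, sub_self]
  rw [← add_sub_cancel (ψ p) q]
  exact Submodule.add_mem_sup ⟨p, rfl⟩ h2

open TensorProduct in
lemma aux_height {R : Type*} [CommRing R] [IsNoetherianRing R] (I : Ideal R) (r : ℕ)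
    (hI : idealHeight I = r) (m : Ideal (R ⧸ I)) (hm : m.IsMaximal) :
    r ≤ Module.finrank ((R ⧸ I) ⧸ m) (((R ⧸ I) ⧸ m) ⊗[R ⧸ I] I.Cotangent) := by
  let := Ideal.Quotient.field m
  have : Module.Finite R I.Cotangent :=
    Module.Finite.of_surjective I.toCotangent I.toCotangent_surjective
  have : Module.Finite (R ⧸ I) I.Cotangent := Module.Finite.of_restrictScalars_finite R _ _
  let b := Module.finBasis ((R ⧸ I) ⧸ m) (((R ⧸ I) ⧸ m) ⊗[R ⧸ I] I.Cotangent)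
  set n := Module.finrank ((R ⧸ I) ⧸ m) (((R ⧸ I) ⧸ m) ⊗[R ⧸ I] I.Cotangent) with hn
  have hx : ∀ i, ∃ x : I, (1 : (R ⧸ I) ⧸ m) ⊗ₜ[R ⧸ I] I.toCotangent x = b i := by
    intro i
    obtain ⟨y, hy⟩ := aux_surj m (b i)
    obtain ⟨x, rfl⟩ := I.toCotangent_surjective y
    exact ⟨x, hy⟩
  choose x hx using hx
  let M : Ideal R := m.comap (Ideal.Quotient.mk I)
  have hM : M.IsMaximal := Ideal.comap_isMaximal_of_surjective _ Ideal.Quotient.mk_surjective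
  have hIM : I ≤ M := fun y hy => by
    simp [M, Ideal.mem_comap, Ideal.Quotient.eq_zero_iff_mem.2 hy]
  let J : Ideal R := Ideal.span (Set.range fun i => (x i : R))
  have hlift : ∀ z ∈ m • (⊤ : Submodule (R ⧸ I) I.Cotangent),
      ∃ w : I, (w : R) ∈ M * I ∧ I.toCotangent w = z := by
    intro z hz
    induction hz using Submodule.smul_induction_on' with
    | smul a ha c hc =>
      obtain ⟨a, rfl⟩ := Ideal.Quotient.mk_surjective a
      obtain ⟨c, rfl⟩ := I.toCotangent_surjective c
      exact ⟨a • c, Ideal.mul_mem_mul ha c.2, by simp; rfl⟩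
    | add c _ d _ h1 h2 =>
      obtain ⟨u, hu, rfl⟩ := h1
      obtain ⟨v, hv, rfl⟩ := h2
      exact ⟨u + v, add_mem hu hv, by simp⟩
  have hle : I ≤ J ⊔ M • I := by
    intro y hy
    have hs := b.sum_repr ((1 : (R ⧸ I) ⧸ m) ⊗ₜ[R ⧸ I] I.toCotangent ⟨y, hy⟩)
    have hc : ∀ i, ∃ a : R, Ideal.Quotient.mk m (Ideal.Quotient.mk I a) =
        b.repr ((1 : (R ⧸ I) ⧸ m) ⊗ₜ[R ⧸ I] I.toCotangent ⟨y, hy⟩) i := by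
      intro i
      obtain ⟨a, ha⟩ := Ideal.Quotient.mk_surjective
        (b.repr ((1 : (R ⧸ I) ⧸ m) ⊗ₜ[R ⧸ I] I.toCotangent ⟨y, hy⟩) i)
      obtain ⟨a, rfl⟩ := Ideal.Quotient.mk_surjective a
      exact ⟨a, ha⟩
    choose a ha using hc
    have h0 : (1 : (R ⧸ I) ⧸ m) ⊗ₜ[R ⧸ I] I.toCotangent (⟨y, hy⟩ - ∑ i, a i • x i) = 0 := by
      rw [map_sub, TensorProduct.tmul_sub, sub_eq_zero, ← hs, map_sum, TensorProduct.tmul_sum]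
      refine Finset.sum_congr rfl fun i _ => ?_
      rw [← ha, ← hx, map_smul]
      have : a i • I.toCotangent (x i) = (Ideal.Quotient.mk I (a i)) • I.toCotangent (x i) := rfl
      rw [this, TensorProduct.tmul_smul]
      rfl
    obtain ⟨w, hw, hw2⟩ := hlift _ (aux_mem m _ h0)
    rw [Ideal.toCotangent_eq] at hw2
    have h3 : (y - ∑ i, a i * (x i : R)) ∈ M * I := by
      have h4 : (w : R) - (y - ∑ i, a i * (x i : R)) ∈ M * I := by
        have := (Ideal.pow_le_pow_right (le_refl 2) : I ^ 2 ≤ I ^ 2) hw2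
        rw [pow_two] at this
        simpa using Ideal.mul_mono_left hIM this
      simpa using sub_mem hw h4
    rw [← add_sub_cancel (∑ i, a i * (x i : R)) y]
    refine Submodule.add_mem_sup (sum_mem fun i _ => ?_) h3
    exact J.mul_mem_left _ (Ideal.subset_span ⟨i, rfl⟩)
  obtain ⟨s, hs, hsI⟩ := Submodule.exists_sub_one_mem_and_smul_le_of_fg_of_le_sup
    (IsNoetherian.noetherian I) le_rfl hle
  have hsM : s ∉ M := fun h => hM.ne_top <| (Ideal.eq_top_iff_one _).2 <| by
    simpa using sub_mem h hs
  have hJI : J ≤ I := Ideal.span_le.2 (by rintro _ ⟨i, rfl⟩; exact (x i).2)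
  obtain ⟨p, hp, hpM⟩ := Ideal.exists_minimalPrimes_le (hJI.trans hIM)
  have hpp : p.IsPrime := hp.1.1
  have hIp : I ≤ p := fun y hy =>
    (hpp.mem_or_mem (hp.1.2 (hsI (Submodule.smul_mem_pointwise_smul y s I hy)))).resolve_left
      fun h => hsM (hpM h)
  have h1 : idealHeight I ≤ Order.height (⟨p, hpp⟩ : PrimeSpectrum R) :=
    iInf₂_le (⟨p, hpp⟩ : PrimeSpectrum R) hIp
  have h2 := Ideal.height_le_spanRank_toENat_of_mem_minimalPrimes J p hp
  have h3 : J.spanRank.toENat ≤ n := by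
    have h5 : J.spanRank ≤ _ := Submodule.spanRank_span_le_card (Set.range fun i => (x i : R))
    have h6 := Cardinal.mk_range_le_lift (f := fun i => (x i : R))
    have h7 : J.spanRank ≤ (n : Cardinal) := h5.trans (by simpa using h6)
    simpa using Cardinal.toENat.monotone' h7
  have h4 : p.height = Order.height (⟨p, hpp⟩ : PrimeSpectrum R) :=
    PrimeSpectrum.height_eq_orderHeight ⟨p, hpp⟩
  rw [hI, ← h4] at h1
  exact_mod_cast h1.trans (h2.trans h3)

/-- Bhatwadekar's lemma: given surjections `α : P ↠ I/I²` and `β : Q ↠ I/I²`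
from finitely generated projective `R/I`-modules of constant rank `r`, where
`I` has height `r`, any `ψ : P → Q` with `β ∘ ψ = α` is an isomorphism. -/
theorem bijective_of_comp_surjections_onto_cotangent
    (R : Type*) [CommRing R] [IsNoetherianRing R] (I : Ideal R) (r : ℕ)
    (hI : idealHeight I = r)
    (P Q : Type*) [AddCommGroup P] [Module (R ⧸ I) P]
    [AddCommGroup Q] [Module (R ⧸ I) Q]
    [Module.Finite (R ⧸ I) P] [Module.Projective (R ⧸ I) P]
    [Module.Finite (R ⧸ I) Q] [Module.Projective (R ⧸ I) Q]
    (hrankP : ∀ (𝔭 : Ideal (R ⧸ I)) (_ : 𝔭.IsPrime),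
      Module.finrank (Localization.AtPrime 𝔭) (LocalizedModule 𝔭.primeCompl P) = r)
    (hrankQ : ∀ (𝔭 : Ideal (R ⧸ I)) (_ : 𝔭.IsPrime),
      Module.finrank (Localization.AtPrime 𝔭) (LocalizedModule 𝔭.primeCompl Q) = r)
    (α : P →ₗ[R ⧸ I] I.Cotangent) (hα : Function.Surjective α)
    (β : Q →ₗ[R ⧸ I] I.Cotangent) (hβ : Function.Surjective β)
    (ψ : P →ₗ[R ⧸ I] Q) (hψ : β ∘ₗ ψ = α) :
    Function.Bijective ψ := by
  have hs : Function.Surjective ψ := by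
    rw [← LinearMap.range_eq_top]
    by_contra hne
    have hann : Module.annihilator (R ⧸ I) (Q ⧸ LinearMap.range ψ) ≠ ⊤ := by
      rw [Ne, Module.annihilator_eq_top_iff, Submodule.Quotient.subsingleton_iff]
      exact hne
    obtain ⟨m, hm, hle⟩ := Ideal.exists_le_maximal _ hann
    have htop := aux_top_le m hm r (aux_finrank m hm r fun p => hrankQ p.asIdeal p.2)
      (aux_height I r hI m hm) α hα β hβ ψ hψ
    obtain ⟨s, hs, hsQ⟩ := Submodule.exists_sub_one_mem_and_smul_le_of_fg_of_le_sup
      (Module.Finite.fg_top) le_rfl htop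
    have hsm : s ∈ m := by
      apply hle
      rw [Module.mem_annihilator]
      intro z
      obtain ⟨q, rfl⟩ := Submodule.Quotient.mk_surjective _ z
      rw [← Submodule.Quotient.mk_smul, Submodule.Quotient.mk_eq_zero]
      exact hsQ (Submodule.smul_mem_pointwise_smul q s ⊤ trivial)
    exact hm.ne_top <| (Ideal.eq_top_iff_one _).2 <| by simpa using sub_mem hsm hs
  refine Module.bijective_of_surjective_of_rankAtStalk_eq hs ?_
  intro m hm
  exact (hrankP m _).trans (hrankQ m _).symm
end

section
/- Let R be a commutative ring, D = R[X,Y]/(XY), and let bar and tilde denote reduction modulo (Y) and (X) respectively, so that D̄ ≅ R[X] and D̃ ≅ R[Y]. Then the square of rings with maps D → R[X], D → R[Y], R[X] → R (evaluation at X = 0), R[Y] → R (evaluation at Y = 0) is Cartesian: D is isomorphic to the fiber product R[X] ×_R R[Y]. -/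
open MvPolynomial

/-- The square expressing `D = R[X,Y]/(XY)` as the fiber product `R[X] ×_R R[Y]`:
the map `R[X,Y] → R[X] × R[Y]`, `X ↦ (X,0)`, `Y ↦ (0,X)`, has kernel `(XY)` and
its range is exactly the set of pairs `(p,q)` with `p(0) = q(0)`. -/
theorem quotient_XY_is_fiber_product
    (R : Type*) [CommRing R] :
    letI φ : MvPolynomial (Fin 2) R →ₐ[R] Polynomial R × Polynomial R :=
      MvPolynomial.aeval
        (fun i : Fin 2 => if i = 0 then ((Polynomial.X : Polynomial R), 0)
          else (0, (Polynomial.X : Polynomial R)))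
    RingHom.ker (φ : MvPolynomial (Fin 2) R →+* Polynomial R × Polynomial R) =
        Ideal.span {(MvPolynomial.X 0 : MvPolynomial (Fin 2) R) * MvPolynomial.X 1} ∧
      Set.range φ = {pq : Polynomial R × Polynomial R |
        pq.1.coeff 0 = pq.2.coeff 0} := by
  set φ : MvPolynomial (Fin 2) R →ₐ[R] Polynomial R × Polynomial R :=
      MvPolynomial.aeval
        (fun i : Fin 2 => if i = 0 then ((Polynomial.X : Polynomial R), 0)
          else (0, (Polynomial.X : Polynomial R))) with hφ
  have h0 : φ (X 0) = (Polynomial.X, 0) := by simp [φ]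
  have h1 : φ (X 1) = (0, Polynomial.X) := by simp [φ]
  have hC : ∀ a, φ (C a) = (Polynomial.C a, Polynomial.C a) := fun a => by
    simp [φ, Prod.algebraMap_apply]
  have hcoeff : ∀ p, (φ p).1.coeff 0 = (φ p).2.coeff 0 := by
    intro p
    induction p using MvPolynomial.induction_on with
    | C a => simp [hC]
    | add p q hp hq => simp [hp, hq]
    | mul_X p i hp =>
      fin_cases i
      · simp [h0]
      · simp [h1]
  have hdvd : ∀ (x : MvPolynomial (Fin 2) R) (q : Polynomial R),
      x ∣ Polynomial.aeval x q - C (q.coeff 0) := by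
    intro x q
    obtain ⟨r, hr⟩ := Polynomial.X_dvd_sub_C (p := q)
    refine ⟨Polynomial.aeval x r, ?_⟩
    have := congrArg (Polynomial.aeval x) hr
    simpa [MvPolynomial.algebraMap_eq] using this
  have key : ∀ p, X 0 * X 1 ∣ p - (Polynomial.aeval (X 0) (φ p).1
      + Polynomial.aeval (X 1) (φ p).2 - C ((φ p).1.coeff 0)) := by
    intro p
    induction p using MvPolynomial.induction_on with
    | C a => simp [hC, MvPolynomial.algebraMap_eq]
    | add p q hp hq =>
      convert dvd_add hp hq using 1
      simp only [map_add, Prod.fst_add, Prod.snd_add, Polynomial.coeff_add]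
      ring
    | mul_X p i hp =>
      obtain ⟨r, hr⟩ := hp
      fin_cases i
      · obtain ⟨t, ht⟩ := hdvd (X 1) (φ p).2
        rw [← hcoeff] at ht
        refine ⟨r * X 0 + t, ?_⟩
        simp [h0]
        linear_combination (X 0) * hr + X 0 * ht
      · obtain ⟨t, ht⟩ := hdvd (X 0) (φ p).1
        refine ⟨r * X 1 + t, ?_⟩
        simp [h1]
        linear_combination (X 1) * hr + X 1 * ht
  refine ⟨?_, ?_⟩
  · ext p
    rw [Ideal.mem_span_singleton, RingHom.mem_ker]
    change φ p = 0 ↔ _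
    constructor
    · intro h
      simpa [h] using key p
    · rintro ⟨r, rfl⟩
      simp [h0, h1, Prod.ext_iff]
  · ext ⟨p, q⟩
    constructor
    · rintro ⟨r, hr⟩
      have := hcoeff r
      rwa [hr] at this
    · intro h
      change p.coeff 0 = q.coeff 0 at h
      have e1 : ∀ p : Polynomial R, φ (Polynomial.aeval (X 0) p) = (p, Polynomial.C (p.coeff 0)) := by
        intro p
        rw [← Polynomial.aeval_algHom_apply, h0]
        ext1
        · change AlgHom.fst R (Polynomial R) (Polynomial R) _ = _
          rw [← Polynomial.aeval_algHom_apply]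
          simp
        · change AlgHom.snd R (Polynomial R) (Polynomial R) _ = _
          rw [← Polynomial.aeval_algHom_apply]
          simpa [Polynomial.algebraMap_eq] using
            (Polynomial.coeff_zero_eq_aeval_zero' (A := Polynomial R) p).symm
      have e2 : ∀ p : Polynomial R, φ (Polynomial.aeval (X 1) p) = (Polynomial.C (p.coeff 0), p) := by
        intro p
        rw [← Polynomial.aeval_algHom_apply, h1]
        ext1
        · change AlgHom.fst R (Polynomial R) (Polynomial R) _ = _
          rw [← Polynomial.aeval_algHom_apply]
          simpa [Polynomial.algebraMap_eq] using
            (Polynomial.coeff_zero_eq_aeval_zero' (A := Polynomial R) p).symm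
        · change AlgHom.snd R (Polynomial R) (Polynomial R) _ = _
          rw [← Polynomial.aeval_algHom_apply]
          simp
      refine ⟨Polynomial.aeval (X 0) p + Polynomial.aeval (X 1) q - C (p.coeff 0), ?_⟩
      rw [map_sub, map_add, e1, e2, hC]
      simp [h]
end

section
/- Let R be a commutative ring, I = (a₁,…,a_n) an ideal of R with n even, and u, v ∈ R with uv ≡ 1 mod I. Assume the unimodular row (v, a₁, …, a_n) is completable to an invertible (n+1)×(n+1) matrix over R. Then there exists an n×n matrix σ over R with det(σ) ≡ u mod I such that the entries of (a₁,…,a_n)σ generate I. -/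
theorem aux_alt (R : Type*) [CommRing R] (n : ℕ) (hn : Even n) :
    ∃ J : Matrix (Fin n) (Fin n) R, IsUnit J.det ∧ ∀ a : Fin n → R, a ⬝ᵥ J.mulVec a = 0 := by
  obtain ⟨m, rfl⟩ := hn
  refine ⟨(Matrix.J (Fin m) R).submatrix finSumFinEquiv.symm finSumFinEquiv.symm, ?_, ?_⟩
  · rw [Matrix.det_submatrix_equiv_self]
    exact Matrix.isUnit_det_J _ _
  · intro a
    rw [Matrix.submatrix_mulVec_equiv]
    rw [dotProduct, ← Equiv.sum_comp finSumFinEquiv, Fintype.sum_sum_type]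
    simp only [Function.comp_apply, Equiv.symm_apply_apply, Equiv.symm_symm, Matrix.J,
      Matrix.fromBlocks_mulVec, Sum.elim_inl, Sum.elim_inr, Pi.add_apply, Matrix.zero_mulVec,
      Matrix.neg_mulVec, Matrix.one_mulVec, Pi.zero_apply, Pi.neg_apply, zero_add, add_zero]
    rw [← Finset.sum_add_distrib]
    exact Finset.sum_eq_zero fun i _ => by ring

theorem aux_diag (R : Type*) [CommRing R] (n : ℕ) (hpos : 0 < n) (t : R) :
    ∃ D : Matrix (Fin n) (Fin n) R, D.det = t := by
  refine ⟨Matrix.diagonal (Pi.mulSingle ⟨0, hpos⟩ t), ?_⟩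
  rw [Matrix.det_diagonal, Finset.prod_eq_single ⟨0, hpos⟩]
  · simp
  · intro b _ hb
    simp [hb]
  · simp

theorem aux_mem_s8 {R : Type*} [CommRing R] {m k : Type*} [Fintype k] (K : Ideal R)
    (A : Matrix m k R) (x : k → R) (hx : ∀ i, x i ∈ K) (j : m) : A.mulVec x j ∈ K :=
  Ideal.sum_mem _ fun i _ => K.mul_mem_left _ (hx i)

theorem aux_mem' {R : Type*} [CommRing R] {k : Type*} [Fintype k] [DecidableEq k] (K : Ideal R)
    (A : Matrix k k R) (hA : IsUnit A.det) (x : k → R) (hx : ∀ i, A.mulVec x i ∈ K) (j : k) :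
    x j ∈ K := by
  have := aux_mem_s8 K A⁻¹ _ hx j
  rwa [Matrix.mulVec_mulVec, Matrix.nonsing_inv_mul _ hA, Matrix.one_mulVec] at this


/-- Lemma (Das–Raja Sridharan): let `I = (a₁,…,a_n)` with `n` even, and `u, v`
with `uv ≡ 1 mod I`. If the row `(v, a₁, …, a_n)` is completable, then there
is `σ ∈ M_n(R)` with `det σ ≡ u mod I` such that the entries of
`(a₁,…,a_n)·σ` generate `I`. -/
theorem exists_matrix_det_u_generating
    (R : Type*) [CommRing R] (n : ℕ) (hn : Even n) (hpos : 0 < n)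
    (a : Fin n → R) (u v : R)
    (huv : u * v - 1 ∈ Ideal.span (Set.range a))
    (hcomp : ∃ M : Matrix (Fin (n + 1)) (Fin (n + 1)) R,
      IsUnit M.det ∧ M 0 = Fin.cons v a) :
    ∃ σ : Matrix (Fin n) (Fin n) R,
      σ.det - u ∈ Ideal.span (Set.range a) ∧
      Ideal.span (Set.range (Matrix.vecMul a σ)) = Ideal.span (Set.range a) := by
  obtain ⟨M, hM, hrow⟩ := hcomp
  obtain ⟨J, hJ, hJa⟩ := aux_alt R n hn
  obtain ⟨s, hs⟩ := hM.exists_right_inv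
  obtain ⟨r, hr⟩ := hJ.exists_right_inv
  obtain ⟨D, hD⟩ := aux_diag R n hpos (s * r)
  have hDu : IsUnit D.det := by
    rw [hD]
    exact (IsUnit.of_mul_eq_one_right _ hs).mul (IsUnit.of_mul_eq_one_right _ hr)
  set I := Ideal.span (Set.range a) with hI
  have haI : ∀ i, a i ∈ I := fun i => Ideal.subset_span ⟨i, rfl⟩
  set B : Matrix (Fin n) (Fin n) R := M.submatrix Fin.succ Fin.succ with hB
  have hvB : M.det - v * B.det ∈ I := by
    rw [Matrix.det_succ_row_zero, Fin.sum_univ_succ]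
    have h0 : M 0 0 = v := by rw [hrow]; rfl
    have h1 : ∀ i : Fin n, M 0 i.succ = a i := fun i => by rw [hrow]; rfl
    simp only [h0, h1, Fin.succAbove_zero]
    simp only [Fin.val_zero, pow_zero, one_mul, ← hB, add_sub_cancel_left]
    exact Ideal.sum_mem _ fun i _ => I.mul_mem_right _ (I.mul_mem_left _ (haI i))
  refine ⟨(D * B * J).transpose, ?_, ?_⟩
  · rw [Matrix.det_transpose, Matrix.det_mul, Matrix.det_mul, hD]
    have e : s * r * B.det * J.det - u
        = -(s * B.det * (u * v - 1)) - s * u * (M.det - v * B.det)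
          + (M.det * s - 1) * u + s * B.det * (J.det * r - 1) := by ring
    rw [e, hs, hr]
    simp only [sub_self, zero_mul, mul_zero, add_zero]
    exact I.sub_mem (I.neg_mem (I.mul_mem_left _ huv)) (I.mul_mem_left _ hvB)
  · rw [Matrix.vecMul_transpose]
    apply le_antisymm
    · rw [Ideal.span_le]
      rintro _ ⟨i, rfl⟩
      exact aux_mem_s8 I _ _ haI i
    · rw [hI, Ideal.span_le]
      rintro _ ⟨j, rfl⟩
      set K := Ideal.span (Set.range ((D * B * J).mulVec a)) with hK
      have hk : ∀ i, D.mulVec (B.mulVec (J.mulVec a)) i ∈ K := fun i => by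
        rw [Matrix.mulVec_mulVec, Matrix.mulVec_mulVec]
        exact Ideal.subset_span ⟨i, rfl⟩
      have hk2 := aux_mem' K D hDu _ hk
      have hk3 : ∀ i, M.mulVec (Fin.cons 0 (J.mulVec a)) i ∈ K := by
        intro i
        refine Fin.cases ?_ (fun i => ?_) i
        · have : M.mulVec (Fin.cons 0 (J.mulVec a)) 0 = 0 := by
            have h := hJa a
            simp only [dotProduct] at h
            rw [Matrix.mulVec, hrow, dotProduct, Fin.sum_univ_succ]
            simpa using h
          rw [this]; exact K.zero_mem
        · have : M.mulVec (Fin.cons 0 (J.mulVec a)) i.succ = B.mulVec (J.mulVec a) i := by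
            rw [Matrix.mulVec, dotProduct, Fin.sum_univ_succ]
            simp [Matrix.mulVec, dotProduct, hB]
          rw [this]; exact hk2 i
      have hk4 := aux_mem' K M hM _ hk3
      exact aux_mem' K J hJ a (fun i => by simpa using hk4 i.succ) j
end

section
/- Let R be a commutative ring, S the multiplicative set of all monic polynomials in R[T]. Then S⁻¹(R[T,T⁻¹]) is isomorphic to S⁻¹(R[T]) = R(T), and dim(R(T)) = dim(R) when R is Noetherian of finite dimension. -/
/-- The multiplicative set of monic polynomials in `R[T]`. -/
def monicSubmonoid (R : Type*) [CommRing R] [Nontrivial R] : Submonoid (Polynomial R) where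
  carrier := {f | f.Monic}
  one_mem' := Polynomial.monic_one
  mul_mem' := fun hf hg => hf.mul hg

open Polynomial in
theorem monic_disjoint_map_C (R : Type*) [CommRing R] [Nontrivial R] (m : Ideal R) (hm : m ≠ ⊤) :
    Disjoint (monicSubmonoid R : Set R[X]) (m.map C : Ideal R[X]) := by
  refine Set.disjoint_left.mpr fun f hf hfm => hm ?_
  have hf' : f.Monic := hf
  have := Ideal.mem_map_C_iff.mp hfm f.natDegree
  rw [hf'.coeff_natDegree] at this
  exact (Ideal.eq_top_iff_one m).mpr this

open Polynomial in
theorem height_le_of_disjoint (R : Type*) [CommRing R] [Nontrivial R] [IsNoetherianRing R]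
    (P : Ideal R[X]) [hP : P.IsPrime] (hd : Disjoint (monicSubmonoid R : Set R[X]) (P : Set R[X])) :
    (P.height : WithBot ℕ∞) ≤ ringKrullDim R := by
  by_cases hmax : P.IsMaximal
  · by_cases hp : (P.comap C).IsMaximal
    · by_cases hne : P = (P.comap C).map C
      · rw [hne, Polynomial.height_map_C]
        exact Ideal.height_le_ringKrullDim_of_isPrime
      · obtain ⟨f, hf, h⟩ := Polynomial.exists_monic_span_sup_map_eq R P hp hne
        refine absurd ?_ (Set.disjoint_left.mp hd (show f ∈ (monicSubmonoid R : Set R[X]) from hf))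
        have : f ∈ (P.comap C).map C ⊔ Ideal.span {f} :=
          Ideal.mem_sup_right (Ideal.mem_span_singleton_self f)
        rwa [← h] at this
    · have hpp : (P.comap C).IsPrime := inferInstance
      obtain ⟨m, hm, hle⟩ := Ideal.exists_le_maximal _ hpp.ne_top
      have hlt : P.comap C < m := lt_of_le_of_ne hle (fun h => hp (h ▸ hm))
      have := hm.isPrime
      have h1 := Ideal.height_add_one_le_of_lt_of_isPrime hlt
      rw [Polynomial.height_eq_height_add_one (P.under R) P]
      refine le_trans ?_ (Ideal.height_le_ringKrullDim_of_isPrime (I := m))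
      exact WithBot.coe_le_coe.mpr h1
  · obtain ⟨m, hm, hle⟩ := Ideal.exists_le_maximal P hP.ne_top
    have hlt : P < m := lt_of_le_of_ne hle (fun h => hmax (h ▸ hm))
    have := hm.isPrime
    have h1 := Ideal.height_add_one_le_of_lt_of_isPrime hlt
    have h2 := Ideal.height_le_ringKrullDim_of_isPrime (I := m)
    rw [Polynomial.ringKrullDim_of_isNoetherianRing] at h2
    have h3 : ((P.height + 1 : ℕ∞) : WithBot ℕ∞) ≤ ringKrullDim R + 1 :=
      (WithBot.coe_le_coe.mpr h1).trans h2
    have hnb : ringKrullDim R ≠ ⊥ := by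
      intro h
      have := ringKrullDim_nonneg_of_nontrivial (R := R)
      simp [h] at this
    obtain ⟨d, hd⟩ := WithBot.ne_bot_iff_exists.mp hnb
    rw [← hd] at h3 ⊢
    rw [← WithBot.coe_one, ← WithBot.coe_add, WithBot.coe_le_coe] at h3
    rw [WithBot.coe_le_coe]
    exact (ENat.add_le_add_iff_right ENat.one_ne_top).mp h3

/-- Inverting the monic polynomials in the Laurent polynomial ring `R[T,T⁻¹]`
yields the ring `R(T) = S⁻¹R[T]`, and `dim R(T) = dim R` for `R` Noetherian of
finite Krull dimension. -/
theorem localization_laurent_at_monic_eq_RT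
    (R : Type*) [CommRing R] [Nontrivial R] [IsNoetherianRing R]
    (hfin : ringKrullDim R < ⊤) :
    Nonempty (Localization ((monicSubmonoid R).map
        (Polynomial.toLaurent (R := R)).toMonoidHom)
      ≃+* Localization (monicSubmonoid R)) ∧
    ringKrullDim (Localization (monicSubmonoid R)) = ringKrullDim R := by
  constructor
  · have hle : Submonoid.powers (Polynomial.X : Polynomial R) ≤ monicSubmonoid R := by
      rw [Submonoid.powers_le]
      exact Polynomial.monic_X
    have hloc : IsLocalization (Submonoid.powers (Polynomial.X : Polynomial R))
      (LaurentPolynomial R) := LaurentPolynomial.isLocalization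
    letI := IsLocalization.localizationAlgebraOfSubmonoidLe (LaurentPolynomial R)
      (Localization (monicSubmonoid R)) _ _ hle
    haveI := IsLocalization.localization_isScalarTower_of_submonoid_le (LaurentPolynomial R)
      (Localization (monicSubmonoid R)) _ _ hle
    haveI h2 := IsLocalization.isLocalization_of_submonoid_le (LaurentPolynomial R)
      (Localization (monicSubmonoid R)) _ _ hle
    have h3 : IsLocalization ((monicSubmonoid R).map
        (Polynomial.toLaurent (R := R)).toMonoidHom) (Localization (monicSubmonoid R)) := h2
    exact ⟨(IsLocalization.algEquiv ((monicSubmonoid R).map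
        (Polynomial.toLaurent (R := R)).toMonoidHom) _ (Localization (monicSubmonoid R))).toRingEquiv⟩
  · apply le_antisymm
    · rw [ringKrullDim_le_iff_height_le]
      intro p hp
      rw [← IsLocalization.height_under (monicSubmonoid R) p]
      refine height_le_of_disjoint R _ ?_
      exact ((IsLocalization.isPrime_iff_isPrime_disjoint (monicSubmonoid R) _ p).mp hp).2
    · rw [ringKrullDim_le_iff_isMaximal_height_le]
      intro m hm
      have hd := monic_disjoint_map_C R m hm.ne_top
      rw [← Polynomial.height_map_C m,
        ← IsLocalization.height_map_of_disjoint (S := Localization (monicSubmonoid R))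
          (monicSubmonoid R) _ hd]
      have := IsLocalization.isPrime_of_isPrime_disjoint (monicSubmonoid R)
        (Localization (monicSubmonoid R)) (m.map Polynomial.C) inferInstance hd
      exact Ideal.height_le_ringKrullDim_of_isPrime
end
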